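/- Let 0 → L → M → N → 0 be an exact sequence of finitely generated S-modules. Then for almost all α, the specialized sequence 0 → L_α → M_α → N_α → 0 (with maps the specializations of the given homomorphisms) is an exact sequence of S_α-modules. -/

import Mathlib

set_option maxHeartbeats 1000000
set_option synthInstance.maxHeartbeats 1000000

noncomputable section

namespace Spl

open MvPolynomial

/-- "Q(α) holds for almost all α ∈ K^m", i.e. away from a proper algebraic
subvariety of `K^m`. -/
def AlmostAll (K : Type) [Field K] (m : ℕ) (Q : (Fin m → K) → Prop) : Prop :=
  ∃ c : MvPolynomial (Fin m) K, c ≠ 0 ∧ ∀ α : Fin m → K, MvPolynomial.eval α c ≠ 0 → Q α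

variable (k K : Type) [Field k] [Field K] [Algebra k K]

/-- the field k(u) of rational functions in u = (u_1, ..., u_m) -/
abbrev kU (m : ℕ) := FractionRing (MvPolynomial (Fin m) k)

/-- the polynomial ring R = k(u)[X_1, ..., X_n] -/
abbrev Rg (m n : ℕ) := MvPolynomial (Fin n) (kU k m)

/-- the subfield k(α) ⊆ K generated by α = (α_1, ..., α_m) over k -/
abbrev kA {m : ℕ} (α : Fin m → K) := IntermediateField.adjoin k (Set.range α)

/-- the polynomial ring R_α = k(α)[X_1, ..., X_n] -/
abbrev Ra {m : ℕ} (n : ℕ) (α : Fin m → K) := MvPolynomial (Fin n) (kA k K α)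

/-- evaluation u ↦ α, from k[u] to k(α) -/
def evalα {m : ℕ} (α : Fin m → K) : MvPolynomial (Fin m) k →+* kA k K α :=
  (MvPolynomial.aeval fun i =>
    (⟨α i, IntermediateField.subset_adjoin k (Set.range α) ⟨i, rfl⟩⟩ : kA k K α)).toRingHom

/-- the inclusion k[u][X] → R = k(u)[X] -/
def toR (m n : ℕ) : MvPolynomial (Fin n) (MvPolynomial (Fin m) k) →+* Rg k m n :=
  MvPolynomial.map (algebraMap (MvPolynomial (Fin m) k) (kU k m))

/-- substitution u ↦ α, from k[u][X] to R_α = k(α)[X] -/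
def toRa {m : ℕ} (n : ℕ) (α : Fin m → K) :
    MvPolynomial (Fin n) (MvPolynomial (Fin m) k) →+* Ra k K n α :=
  MvPolynomial.map (evalα k K α)

/-- Krull's specialization I_α = { f(α,X) | f(u,X) ∈ I ∩ k[u,X] } of an ideal I ⊆ R
(as an ideal of R_α, i.e. the ideal spanned by the specialized elements). -/
def idealSpec {m : ℕ} (n : ℕ) (α : Fin m → K) (I : Ideal (Rg k m n)) :
    Ideal (Ra k K n α) :=
  Ideal.span (toRa k K n α '' { f | toR k m n f ∈ I })

/-- `ElemSpec k K n α f fα` : fα is the specialization of f ∈ R at α, i.e. writing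
f = p(u,X)/q(u) with q(α) ≠ 0 one has fα = p(α,X)/q(α). -/
def ElemSpec {m : ℕ} (n : ℕ) (α : Fin m → K) (f : Rg k m n) (fα : Ra k K n α) : Prop :=
  ∃ (p : MvPolynomial (Fin n) (MvPolynomial (Fin m) k)) (q : MvPolynomial (Fin m) k),
    evalα k K α q ≠ 0 ∧
    MvPolynomial.C (algebraMap (MvPolynomial (Fin m) k) (kU k m) q) * f = toR k m n p ∧
    MvPolynomial.C (evalα k K α q) * fα = toRa k K n α p

variable {k K}

/-- `LocElemSpec P ℘ a aα` : aα ∈ S_α = (R_α)_℘ is the specialization of a ∈ S = R_P,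
i.e. writing a = f/g with f, g ∈ R, g ∉ P, one has g_α ∉ ℘ and aα = f_α/g_α. -/
def LocElemSpec {m n : ℕ} {α : Fin m → K} (P : Ideal (Rg k m n)) [P.IsPrime]
    (℘ : Ideal (Ra k K n α)) [℘.IsPrime]
    {S : Type} [CommRing S] [Algebra (Rg k m n) S] [IsLocalization.AtPrime S P]
    {Sα : Type} [CommRing Sα] [Algebra (Ra k K n α) Sα] [IsLocalization.AtPrime Sα ℘]
    (a : S) (aα : Sα) : Prop :=
  ∃ (f g : Rg k m n) (fα gα : Ra k K n α) (hg : g ∈ P.primeCompl)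
    (hgα : gα ∈ ℘.primeCompl),
    ElemSpec k K n α f fα ∧ ElemSpec k K n α g gα ∧
    a = IsLocalization.mk' S f ⟨g, hg⟩ ∧
    aα = IsLocalization.mk' Sα fα ⟨gα, hgα⟩

/-- entrywise specialization of matrices, relative to an element-specialization
relation `E`. -/
def MatSpec {S T : Type} (E : S → T → Prop) {r s : ℕ}
    (A : Matrix (Fin r) (Fin s) S) (B : Matrix (Fin r) (Fin s) T) : Prop :=
  ∀ i j, E (A i j) (B i j)

/-- the cokernel of the linear map attached to a matrix A, i.e. the module
presented by A. -/
abbrev MatCoker {S : Type} [CommRing S] {r s : ℕ} (A : Matrix (Fin r) (Fin s) S) :=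
  (Fin r → S) ⧸ LinearMap.range A.mulVecLin

/-- a finite free presentation F_1 → F_0 → L → 0 of the module L, where the map
F_1 → F_0 is given by the matrix A and the map F_0 → L is π. -/
structure Present (S : Type) [CommRing S] (r s : ℕ) (L : Type) [AddCommGroup L]
    [Module S L] where
  A : Matrix (Fin r) (Fin s) S
  π : (Fin r → S) →ₗ[S] L
  surj : Function.Surjective π
  ker_eq : LinearMap.ker π = LinearMap.range A.mulVecLin

theorem comm_le {S : Type} [CommRing S] {r s r' s' : ℕ} {B : Matrix (Fin r) (Fin s) S}
    {C : Matrix (Fin r') (Fin s') S} {W : Matrix (Fin r') (Fin r) S}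
    {W1 : Matrix (Fin s') (Fin s) S} (h : W * B = C * W1) :
    LinearMap.range B.mulVecLin ≤ (LinearMap.range C.mulVecLin).comap W.mulVecLin := by
  rintro x ⟨y, rfl⟩
  exact ⟨W1.mulVecLin y, by
    simp only [Matrix.mulVecLin_apply, Matrix.mulVec_mulVec, h]⟩

/-- the map between the modules presented by B and C induced by the matrix W
(a specialization of a lift of a map between the presented modules). -/
def cokerMap {S : Type} [CommRing S] {r s r' s' : ℕ} {B : Matrix (Fin r) (Fin s) S}
    {C : Matrix (Fin r') (Fin s') S} (W : Matrix (Fin r') (Fin r) S)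
    (h : LinearMap.range B.mulVecLin ≤ (LinearMap.range C.mulVecLin).comap W.mulVecLin) :
    MatCoker B →ₗ[S] MatCoker C :=
  Submodule.mapQ _ _ W.mulVecLin h

/-- a lift of a homomorphism v : L → M to given finite free presentations of L and M:
a commutative diagram whose vertical maps are given by the matrices V1, V0. -/
structure MapLift {S : Type} [CommRing S] {rL sL rM sM : ℕ} {L M : Type}
    [AddCommGroup L] [Module S L] [AddCommGroup M] [Module S M]
    (pL : Present S rL sL L) (pM : Present S rM sM M) (v : L →ₗ[S] M) where
  V0 : Matrix (Fin rM) (Fin rL) S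
  V1 : Matrix (Fin sM) (Fin sL) S
  comm0 : pM.π ∘ₗ V0.mulVecLin = v ∘ₗ pL.π
  comm1 : V0 * pL.A = pM.A * V1

/-- Krull dimension of a module, dim L = dim S/Ann L. -/
def moduleDim (S : Type) [CommRing S] (L : Type) [AddCommGroup L] [Module S L] :
    WithBot ℕ∞ :=
  ringKrullDim (S ⧸ Module.annihilator S L)

/-- height of an ideal: the infimum of dim S_p over the primes p ⊇ I. -/
def idealHeight {S : Type} [CommRing S] (I : Ideal S) : WithBot ℕ∞ :=
  sInf { d | ∃ (p : Ideal S) (hp : p.IsPrime), I ≤ p ∧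
    d = ringKrullDim (Localization (@Ideal.primeCompl _ _ p hp)) }

/-- length of a module: the longest chain of submodules. -/
def moduleLength (S : Type) [CommRing S] (L : Type) [AddCommGroup L] [Module S L] :
    WithBot ℕ∞ :=
  Order.krullDim (Submodule S L)

/-- grade(𝔞, L) ≥ t : there is an L-regular sequence of length t in 𝔞. -/
def GradeGE {S : Type} [CommRing S] (𝔞 : Ideal S) (L : Type) [AddCommGroup L]
    [Module S L] (t : ℕ) : Prop :=
  ∃ rs : List S, rs.length = t ∧ (∀ x ∈ rs, x ∈ 𝔞) ∧ RingTheory.Sequence.IsRegular L rs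

/-- grade(𝔞, L) : the length of a maximal L-regular sequence in 𝔞. -/
def grade {S : Type} [CommRing S] (𝔞 : Ideal S) (L : Type) [AddCommGroup L]
    [Module S L] : ℕ∞ :=
  sSup { t : ℕ∞ | ∃ t' : ℕ, t = (t' : ℕ∞) ∧ GradeGE 𝔞 L t' }

/-- depth of a module over a local ring: grade(𝔪, L). -/
def depth (S : Type) [CommRing S] [IsLocalRing S] (L : Type) [AddCommGroup L]
    [Module S L] : ℕ∞ :=
  grade (IsLocalRing.maximalIdeal S) L

/-- proj dim L ≤ d : L admits a finite free resolution of length ≤ d, encoded as a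
(possibly infinite) free resolution ⋯ → F_1 → F_0 → L → 0 with F_j = 0 for j > d. -/
def ProjDimLE (S : Type) [CommRing S] (L : Type) [AddCommGroup L] [Module S L]
    (d : ℕ) : Prop :=
  ∃ (r : ℕ → ℕ) (A : ∀ j : ℕ, Matrix (Fin (r j)) (Fin (r (j + 1))) S)
    (π : (Fin (r 0) → S) →ₗ[S] L),
    Function.Surjective π ∧ LinearMap.ker π = LinearMap.range (A 0).mulVecLin ∧
    (∀ j : ℕ, LinearMap.ker (A j).mulVecLin = LinearMap.range (A (j + 1)).mulVecLin) ∧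
    ∀ j : ℕ, d < j → r j = 0

/-- projective dimension of a module, as an extended natural number. -/
def projDim (S : Type) [CommRing S] (L : Type) [AddCommGroup L] [Module S L] : ℕ∞ :=
  sInf { d : ℕ∞ | ∃ d' : ℕ, d = (d' : ℕ∞) ∧ ProjDimLE S L d' }

/-- the i-th local cohomology module H^i_𝔞(L) as a module. -/
abbrev localCoh {S : Type} [CommRing S] (𝔞 : Ideal S) (i : ℕ) (L : Type)
    [AddCommGroup L] [Module S L] : ModuleCat S :=
  (localCohomology 𝔞 i).obj (ModuleCat.of S L)

/-- the colon submodule (0 :_L 𝔞) = { x ∈ L | 𝔞 x = 0 }. -/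
def colonSubmodule {S : Type} [CommRing S] (𝔞 : Ideal S) (L : Type) [AddCommGroup L]
    [Module S L] : Submodule S L where
  carrier := { x | ∀ c ∈ 𝔞, c • x = 0 }
  add_mem' := by
    intro a b ha hb c hc
    rw [smul_add, ha c hc, hb c hc, add_zero]
  zero_mem' := by
    intro c _
    rw [smul_zero]
  smul_mem' := by
    intro s x hx c hc
    rw [smul_comm, hx c hc, smul_zero]

/-- a (partial) system of parameters: the d = dim L elements a_1, ..., a_d lie in the
maximal ideal and L/(a_1, ..., a_d)L has dimension ≤ 0. -/
def IsSOP (S : Type) [CommRing S] [IsLocalRing S] (L : Type) [AddCommGroup L]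
    [Module S L] {d : ℕ} (a : Fin d → S) : Prop :=
  (∀ i, a i ∈ IsLocalRing.maximalIdeal S) ∧
  moduleDim S L = (d : ℕ∞) ∧
  moduleDim S (L ⧸ (Ideal.span (Set.range a) • (⊤ : Submodule S L))) ≤ 0

/-- a standard system of parameters: (a_1, ..., a_d) H^i_𝔪(L/(a_1, ..., a_j)L) = 0
for all i + j < d. -/
def IsStandardSOP (S : Type) [CommRing S] [IsLocalRing S] (L : Type) [AddCommGroup L]
    [Module S L] {d : ℕ} (a : Fin d → S) : Prop :=
  IsSOP S L a ∧
  ∀ i j : ℕ, i + j < d →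
    Ideal.span (Set.range a) ≤ Module.annihilator S
      (localCoh (IsLocalRing.maximalIdeal S) i
        (L ⧸ (Ideal.span (a '' { x : Fin d | (x : ℕ) < j }) • (⊤ : Submodule S L))))

/-- a standard ideal for L: an 𝔪-primary ideal 𝔞 such that every system of
parameters of L contained in 𝔞 is standard. -/
def IsStandardIdeal (S : Type) [CommRing S] [IsLocalRing S] (L : Type) [AddCommGroup L]
    [Module S L] (𝔞 : Ideal S) : Prop :=
  𝔞.radical = IsLocalRing.maximalIdeal S ∧
  ∀ (d : ℕ) (a : Fin d → S), (∀ i, a i ∈ 𝔞) → IsSOP S L a → IsStandardSOP S L a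


section LeadingTerms

variable {σ J A F : Type} [CommRing A] [Field F] (O : MonomialOrder σ)

/-- The coefficient of a vector of polynomials at a pair (position, exponent). -/
def vecCoeff (w : J ×ₗ O.syn) : (J → MvPolynomial σ A) →ₗ[A] A :=
  MvPolynomial.lcoeff A (O.toSyn.symm (ofLex w).2) ∘ₗ LinearMap.proj (ofLex w).1

theorem vecCoeff_apply (w : J ×ₗ O.syn) (v : J → MvPolynomial σ A) :
    vecCoeff O w v = (v (ofLex w).1).coeff (O.toSyn.symm (ofLex w).2) := rfl

/-- Entrywise application of `φ` to a vector of polynomials. -/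
abbrev vecMap (φ : A →+* F) : (J → MvPolynomial σ A) →+* (J → MvPolynomial σ F) :=
  (MvPolynomial.map φ).compLeft J

theorem vecMap_apply (φ : A →+* F) (v : J → MvPolynomial σ A) (j : J) :
    vecMap φ v j = MvPolynomial.map φ (v j) := rfl

theorem vecMap_smul (φ : A →+* F) (p : MvPolynomial σ A) (v : J → MvPolynomial σ A) :
    vecMap φ (p • v) = MvPolynomial.map φ p • vecMap φ v := by
  ext1 j
  simp only [vecMap_apply, Pi.smul_apply, smul_eq_mul, map_mul]

theorem vecMap_smul_base (φ : A →+* F) (a : A) (v : J → MvPolynomial σ A) :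
    vecMap φ (a • v) = φ a • vecMap φ v := by
  ext1 j
  simp only [vecMap_apply, Pi.smul_apply, MvPolynomial.smul_eq_C_mul, map_mul, MvPolynomial.map_C]

theorem vecCoeff_vecMap (φ : A →+* F) (w : J ×ₗ O.syn) (v : J → MvPolynomial σ A) :
    vecCoeff O w (vecMap φ v) = φ (vecCoeff O w v) := by
  simp only [vecCoeff_apply, vecMap_apply, MvPolynomial.coeff_map]

variable [LinearOrder J]

/-- `w` is the leading (position, exponent) pair of the vector `v`, in the position-over-term
order. -/
def IsLead (v : J → MvPolynomial σ A) (w : J ×ₗ O.syn) : Prop :=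
  vecCoeff O w v ≠ 0 ∧ ∀ w', w < w' → vecCoeff O w' v = 0

theorem exists_isLead [Finite J] {v : J → MvPolynomial σ A} (hv : v ≠ 0) :
    ∃ w, IsLead O v w := by
  have hfin : {w : J ×ₗ O.syn | vecCoeff O w v ≠ 0}.Finite := by
    refine (Set.finite_iUnion fun j => ((v j).support.finite_toSet.image
      fun β => (toLex (j, O.toSyn β) : J ×ₗ O.syn))).subset ?_
    intro w hw
    exact Set.mem_iUnion.2 ⟨(ofLex w).1, O.toSyn.symm (ofLex w).2,
      MvPolynomial.mem_support_iff.2 hw, by simp⟩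
  have hne : {w : J ×ₗ O.syn | vecCoeff O w v ≠ 0}.Nonempty := by
    obtain ⟨j, hj⟩ := Function.ne_iff.1 hv
    obtain ⟨β, hβ⟩ := MvPolynomial.ne_zero_iff.1 hj
    exact ⟨toLex (j, O.toSyn β), by simpa [vecCoeff_apply] using hβ⟩
  obtain ⟨w, hw, hmax⟩ := Set.exists_max_image _ id hfin hne
  refine ⟨w, hw, fun w' hw' => ?_⟩
  by_contra h
  exact absurd (hmax w' h) (not_le.2 hw')

theorem IsLead.monomial_smul {v : J → MvPolynomial σ A} {j : J} {β : σ →₀ ℕ}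
    (h : IsLead O v (toLex (j, O.toSyn β))) (γ : σ →₀ ℕ) :
    IsLead O (MvPolynomial.monomial γ (1 : A) • v) (toLex (j, O.toSyn (γ + β))) ∧
    vecCoeff O (toLex (j, O.toSyn (γ + β))) (MvPolynomial.monomial γ (1 : A) • v) =
      vecCoeff O (toLex (j, O.toSyn β)) v := by
  have key : vecCoeff O (toLex (j, O.toSyn (γ + β))) (MvPolynomial.monomial γ (1 : A) • v) =
      vecCoeff O (toLex (j, O.toSyn β)) v := by
    simp only [vecCoeff_apply, ofLex_toLex, AddEquiv.symm_apply_apply, Pi.smul_apply, smul_eq_mul,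
      MvPolynomial.coeff_monomial_mul, one_mul]
  refine ⟨⟨key ▸ h.1, fun w' hw' => ?_⟩, key⟩
  simp only [vecCoeff_apply, Pi.smul_apply, smul_eq_mul, MvPolynomial.coeff_monomial_mul', one_mul]
  split_ifs with hle
  · have := h.2 (toLex ((ofLex w').1, O.toSyn (O.toSyn.symm (ofLex w').2 - γ))) (by
      rw [Prod.Lex.lt_iff] at hw' ⊢
      refine hw'.imp id fun h' => ⟨h'.1, ?_⟩
      have h2 := h'.2
      simp only [ofLex_toLex] at h2 ⊢
      rw [← add_lt_add_iff_left (O.toSyn γ), ← map_add, ← map_add, add_tsub_cancel_of_le hle]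
      simpa using h2)
    simpa [vecCoeff_apply] using this
  · rfl

variable {O}

/-- Images of a system of elements realizing all leading pairs of `N` span the image of `N`. -/
theorem vecMap_mem_span_of_isLead [Finite J] (φ : A →+* F)
    {N : Submodule A (J → MvPolynomial σ A)} {e : J ×ₗ O.syn → J → MvPolynomial σ A}
    (he : ∀ w, (∃ f ∈ N, IsLead O f w) →
      e w ∈ N ∧ IsLead O (e w) w ∧ φ (vecCoeff O w (e w)) ≠ 0)
    {f : J → MvPolynomial σ A} (hf : f ∈ N) :
    vecMap φ f ∈ Submodule.span F
      (Set.range fun w : {w | ∃ f ∈ N, IsLead O f w} => vecMap φ (e w)) := by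
  have : WellFoundedLT J := Finite.to_wellFoundedLT
  by_cases h0 : f = 0
  · simp only [h0, map_zero, Submodule.zero_mem]
  obtain ⟨w, hw⟩ := exists_isLead O h0
  clear h0
  induction w using WellFoundedLT.induction generalizing f with
  | ind w ih =>
  obtain ⟨heN, hel, hφ⟩ := he w ⟨f, hf, hw⟩
  set f' := vecCoeff O w (e w) • f - vecCoeff O w f • e w with hf'
  have hf'N : f' ∈ N := N.sub_mem (N.smul_mem _ hf) (N.smul_mem _ heN)
  have hmem : vecMap φ f' ∈ Submodule.span F
      (Set.range fun w : {w | ∃ f ∈ N, IsLead O f w} => vecMap φ (e w)) := by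
    by_cases h0 : f' = 0
    · simp only [h0, map_zero, Submodule.zero_mem]
    obtain ⟨w', hw'⟩ := exists_isLead O h0
    refine ih w' ?_ hf'N hw'
    by_contra hlt
    refine hw'.1 ?_
    rcases eq_or_lt_of_le (not_lt.1 hlt) with rfl | hlt
    · simp [hf', mul_comm]
    · simp [hf', hel.2 _ hlt, hw.2 _ hlt]
  rw [hf', map_sub, vecMap_smul_base, vecMap_smul_base] at hmem
  have hew : vecMap φ (e w) ∈ Submodule.span F
      (Set.range fun w : {w | ∃ f ∈ N, IsLead O f w} => vecMap φ (e w)) :=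
    Submodule.subset_span ⟨⟨w, f, hf, hw⟩, rfl⟩
  have := Submodule.add_mem _ hmem (Submodule.smul_mem _ (φ (vecCoeff O w f)) hew)
  rw [sub_add_cancel] at this
  exact (Submodule.smul_mem_iff _ hφ).1 this

/-- If the leading coefficients stay nonzero under `φ`, an element of the span of the image
of `N` supported in an initial segment `I` of positions comes from elements of `N` supported
in `I`. -/
theorem mem_span_vecMap_of_isLead [Finite J] (φ : A →+* F)
    {N : Submodule A (J → MvPolynomial σ A)} {e : J ×ₗ O.syn → J → MvPolynomial σ A}
    (he : ∀ w, (∃ f ∈ N, IsLead O f w) →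
      e w ∈ N ∧ IsLead O (e w) w ∧ φ (vecCoeff O w (e w)) ≠ 0)
    {I : Set J} (hI : IsLowerSet I) {y : J → MvPolynomial σ F}
    (hy : y ∈ Submodule.span F (vecMap φ '' N)) (hyI : ∀ j ∉ I, y j = 0) :
    y ∈ Submodule.span F (vecMap φ '' {f | f ∈ N ∧ ∀ j ∉ I, f j = 0}) := by
  have hy' : y ∈ Submodule.span F
      (Set.range fun w : {w | ∃ f ∈ N, IsLead O f w} => vecMap φ (e w)) := by
    refine Submodule.span_le.2 ?_ hy
    rintro _ ⟨f, hf, rfl⟩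
    exact vecMap_mem_span_of_isLead φ he hf
  obtain ⟨l, rfl⟩ := Finsupp.mem_span_range_iff_exists_finsupp.1 hy'
  rcases l.support.eq_empty_or_nonempty with h0 | hne
  · simp [Finsupp.support_eq_empty.1 h0]
  obtain ⟨w₀, hw₀, hmax⟩ := l.support.exists_max_image (fun w => (w : J ×ₗ O.syn)) hne
  have hcoef : vecCoeff O w₀.1 (l.sum fun w a => a • vecMap φ (e w)) =
      l w₀ * φ (vecCoeff O w₀.1 (e w₀)) := by
    rw [Finsupp.sum, map_sum, Finset.sum_eq_single w₀]
    · rw [map_smul, vecCoeff_vecMap, smul_eq_mul]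
    · intro w hw hne
      have hlt : w.1 < w₀.1 := lt_of_le_of_ne (hmax w hw) fun h => hne (Subtype.ext h)
      rw [map_smul, vecCoeff_vecMap, (he w w.2).2.1.2 _ hlt, map_zero, smul_zero]
    · intro h
      exact absurd hw₀ h
  have hw₀I : (ofLex w₀.1).1 ∈ I := by
    by_contra h
    have h1 : vecCoeff O w₀.1 (l.sum fun w a => a • vecMap φ (e w)) = 0 := by
      rw [vecCoeff_apply, hyI _ h, MvPolynomial.coeff_zero]
    rw [hcoef] at h1
    exact mul_ne_zero (Finsupp.mem_support_iff.1 hw₀) (he w₀ w₀.2).2.2 h1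
  refine Submodule.sum_mem _ fun w hw => Submodule.smul_mem _ _ (Submodule.subset_span ?_)
  refine ⟨e w, ⟨(he w w.2).1, fun j hj => ?_⟩, rfl⟩
  ext β
  have hlt : w.1 < toLex (j, O.toSyn β) := by
    refine lt_of_le_of_lt (hmax w hw) (Prod.Lex.lt_iff.2 (Or.inl ?_))
    by_contra hle
    exact hj (hI (not_lt.1 hle) hw₀I)
  simpa [vecCoeff_apply] using (he w w.2).2.1.2 _ hlt

variable (O)

/-- Dickson's lemma gives finitely many elements of `N` whose monomial multiples realize all
leading pairs of `N`; `c` is the product of their leading coefficients. -/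
theorem exists_ne_zero_isLead [IsDomain A] [Finite σ] [Finite J]
    (N : Submodule (MvPolynomial σ A) (J → MvPolynomial σ A)) :
    ∃ c : A, c ≠ 0 ∧ ∃ e : J ×ₗ O.syn → J → MvPolynomial σ A,
      ∀ w, (∃ f ∈ N, IsLead O f w) →
        e w ∈ N ∧ IsLead O (e w) w ∧ vecCoeff O w (e w) ∣ c := by
  classical
  have := Fintype.ofFinite J
  let U : J → Set (σ →₀ ℕ) := fun j => {β | ∃ f ∈ N, IsLead O f (toLex (j, O.toSyn β))}
  have hmin (j : J) : {β | Minimal (· ∈ U j) β}.Finite :=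
    (setOfPred_minimal_antichain (· ∈ U j)).finite_of_partiallyWellOrderedOn
      (Set.isPWO_of_wellQuasiOrderedLE _)
  have hch : ∀ j β, ∃ f, β ∈ U j → f ∈ N ∧ IsLead O f (toLex (j, O.toSyn β)) := by
    intro j β
    by_cases h : β ∈ U j
    · obtain ⟨f, hf⟩ := h
      exact ⟨f, fun _ => hf⟩
    · exact ⟨0, fun h' => absurd h' h⟩
  choose f hf using hch
  refine ⟨∏ j, ∏ β ∈ (hmin j).toFinset, vecCoeff O (toLex (j, O.toSyn β)) (f j β), ?_, ?_⟩
  · refine Finset.prod_ne_zero_iff.2 fun j _ => Finset.prod_ne_zero_iff.2 fun β hβ => ?_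
    exact (hf j β ((hmin j).mem_toFinset.1 hβ).prop).2.1
  have hch2 : ∀ w : J ×ₗ O.syn, ∃ g : J → MvPolynomial σ A, (∃ f ∈ N, IsLead O f w) →
      g ∈ N ∧ IsLead O g w ∧ vecCoeff O w g ∣
        ∏ j, ∏ β ∈ (hmin j).toFinset, vecCoeff O (toLex (j, O.toSyn β)) (f j β) := by
    intro w
    by_cases h : ∃ f ∈ N, IsLead O f w
    swap
    · exact ⟨0, fun h' => absurd h' h⟩
    obtain ⟨j, s⟩ := w
    obtain ⟨β, rfl⟩ := O.toSyn.surjective s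
    obtain ⟨γ, hγβ, hγ⟩ := (Set.isPWO_of_wellQuasiOrderedLE (U j)).exists_le_minimal
      (show β ∈ U j from h)
    obtain ⟨δ, rfl⟩ := exists_add_of_le hγβ
    obtain ⟨hfN, hfl⟩ := hf j γ hγ.prop
    obtain ⟨h1, h2⟩ := hfl.monomial_smul O δ
    rw [add_comm] at h1 h2
    refine ⟨MvPolynomial.monomial δ 1 • f j γ, fun _ => ⟨N.smul_mem _ hfN, h1, ?_⟩⟩
    refine (dvd_of_eq h2).trans ?_
    exact (Finset.dvd_prod_of_mem (fun γ => vecCoeff O (toLex (j, O.toSyn γ)) (f j γ))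
      ((hmin j).mem_toFinset.2 hγ)).trans (Finset.dvd_prod_of_mem
        (fun j => ∏ β ∈ (hmin j).toFinset, vecCoeff O (toLex (j, O.toSyn β)) (f j β))
        (Finset.mem_univ j))
  choose e he using hch2
  exact ⟨e, he⟩

end LeadingTerms

/-- The `F`-span of the image of an `A[X]`-submodule is stable under `F[X]`. -/
theorem span_vecMap_eq {σ J A F : Type} [CommRing A] [Field F] (φ : A →+* F)
    (N : Submodule (MvPolynomial σ A) (J → MvPolynomial σ A)) {y : J → MvPolynomial σ F}
    (hy : y ∈ Submodule.span (MvPolynomial σ F) (vecMap φ '' (N : Set (J → MvPolynomial σ A)))) :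
    y ∈ Submodule.span F (vecMap φ '' (N : Set (J → MvPolynomial σ A))) := by
  have hsmul (p : MvPolynomial σ F) :
      ∀ z ∈ Submodule.span F (vecMap φ '' (N : Set (J → MvPolynomial σ A))),
      p • z ∈ Submodule.span F (vecMap φ '' (N : Set (J → MvPolynomial σ A))) := by
    induction p using MvPolynomial.induction_on with
    | C a =>
      intro z hz
      rw [← MvPolynomial.algebraMap_eq, algebraMap_smul]
      exact Submodule.smul_mem _ _ hz
    | add p q hp hq =>
      intro z hz
      rw [add_smul]
      exact Submodule.add_mem _ (hp z hz) (hq z hz)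
    | mul_X p i hp =>
      intro z hz
      rw [mul_smul]
      refine hp _ ?_
      induction hz using Submodule.span_induction with
      | mem x hx =>
        obtain ⟨f, hf, rfl⟩ := hx
        refine Submodule.subset_span ⟨MvPolynomial.X i • f, N.smul_mem _ hf, ?_⟩
        rw [vecMap_smul, MvPolynomial.map_X]
      | zero => rw [smul_zero]; exact Submodule.zero_mem _
      | add x y _ _ hx hy => rw [smul_add]; exact Submodule.add_mem _ hx hy
      | smul a x _ hx => rw [smul_comm]; exact Submodule.smul_mem _ _ hx
  induction hy using Submodule.span_induction with
  | mem x hx => exact Submodule.subset_span hx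
  | zero => exact Submodule.zero_mem _
  | add x y _ _ hx hy => exact Submodule.add_mem _ hx hy
  | smul a x _ hx => exact hsmul a x hx

/-- The kernel of a matrix over `A[X]` commutes with specialization of the coefficients,
outside the zero locus of some nonzero `c`. -/
theorem exists_ne_zero_ker_specialization {σ ι κ A : Type} [Finite σ] [Fintype ι] [Fintype κ]
    [CommRing A] [IsDomain A] [IsNoetherianRing A]
    (B : Matrix ι κ (MvPolynomial σ A)) :
    ∃ (r : ℕ) (C : Matrix κ (Fin r) (MvPolynomial σ A)), B * C = 0 ∧ ∃ c : A, c ≠ 0 ∧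
      ∀ (F : Type) [Field F] (φ : A →+* F), φ c ≠ 0 → ∀ x : κ → MvPolynomial σ F,
        (B.map (MvPolynomial.map φ)).mulVec x = 0 →
          ∃ y, x = (C.map (MvPolynomial.map φ)).mulVec y := by
  classical
  let lκ : LinearOrder κ := LinearOrder.lift' _ (Fintype.equivFin κ).injective
  let lι : LinearOrder ι := LinearOrder.lift' _ (Fintype.equivFin ι).injective
  let lσ : LinearOrder σ := LinearOrder.lift' _ (Finite.equivFin σ).injective
  let O : MonomialOrder σ := MonomialOrder.lex
  let emb : (κ → MvPolynomial σ A) →ₗ[MvPolynomial σ A] (κ ⊕ₗ ι → MvPolynomial σ A) :=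
    { toFun := fun z => Sum.elim z (B.mulVec z)
      map_add' := by
        intro x y
        rw [Matrix.mulVec_add, Sum.elim_add_add]
        rfl
      map_smul' := by
        intro a x
        rw [Matrix.mulVec_smul]
        ext1 s
        rcases s with s | s <;> rfl }
  obtain ⟨c, hc, e, he⟩ := exists_ne_zero_isLead O (LinearMap.range emb)
  obtain ⟨r, C₀, hC₀⟩ := Submodule.fg_iff_exists_fin_generating_family.1
    (IsNoetherian.noetherian (LinearMap.ker B.mulVecLin))
  refine ⟨r, Matrix.of fun i j => C₀ j i, ?_, c, hc, ?_⟩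
  · ext1 i j
    have : C₀ j ∈ LinearMap.ker B.mulVecLin := hC₀ ▸ Submodule.subset_span ⟨j, rfl⟩
    exact congrFun this i
  intro F _ φ hφ x hx
  let y : κ ⊕ₗ ι → MvPolynomial σ F := Sum.elim x 0
  have hy : y ∈ Submodule.span (MvPolynomial σ F) (vecMap φ '' (LinearMap.range emb : Set _)) := by
    have hsum : y = ∑ t, x t • vecMap φ (emb (Pi.single t 1)) := by
      ext1 s
      rw [Finset.sum_apply]
      rcases s with s | s
      · rw [Finset.sum_eq_single s]
        · change x s = x s * MvPolynomial.map φ (Pi.single (M := fun _ => MvPolynomial σ A) s 1 s)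
          simp
        · intro t _ hts
          change x t * MvPolynomial.map φ (Pi.single (M := fun _ => MvPolynomial σ A) t 1 s) = 0
          simp [Pi.single_eq_of_ne hts.symm]
        · simp
      · refine (congrFun hx s).symm.trans (Finset.sum_congr rfl fun t _ => ?_)
        change _ = x t * MvPolynomial.map φ (B.mulVec (Pi.single t 1) s)
        rw [Matrix.mulVec_single_one, mul_comm]
        rfl
    rw [hsum]
    exact Submodule.sum_mem _ fun t _ =>
      Submodule.smul_mem _ _ (Submodule.subset_span ⟨_, ⟨_, rfl⟩, rfl⟩)
  have hI : IsLowerSet (Set.range (Sum.inlₗ : κ → κ ⊕ₗ ι)) := by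
    rintro _ b hb ⟨a, rfl⟩
    rcases b with b | b
    · exact ⟨b, rfl⟩
    · exact absurd hb (Sum.Lex.not_inr_le_inl)
  have hmem := mem_span_vecMap_of_isLead (N := (LinearMap.range emb).restrictScalars A) φ
    (fun w hw => ⟨(he w hw).1, (he w hw).2.1, fun h0 => hφ (by
      obtain ⟨a, ha⟩ := (he w hw).2.2
      rw [ha, map_mul, h0, zero_mul])⟩) hI (span_vecMap_eq φ _ hy) (by
      rintro (j | j) hj
      · exact absurd ⟨j, rfl⟩ hj
      · rfl)
  suffices ∀ z ∈ Submodule.span F (vecMap φ '' {f | f ∈ (LinearMap.range emb).restrictScalars A ∧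
      ∀ j ∉ Set.range (Sum.inlₗ : κ → κ ⊕ₗ ι), f j = 0}),
      ∃ t, (fun i => z (Sum.inlₗ i)) =
        ((Matrix.of fun i j => C₀ j i).map (MvPolynomial.map φ)).mulVec t from this y hmem
  intro z hz
  induction hz using Submodule.span_induction with
  | mem z hz =>
    obtain ⟨_, ⟨⟨f, rfl⟩, hf⟩, rfl⟩ := hz
    have hker : f ∈ LinearMap.ker B.mulVecLin := by
      ext1 i
      exact hf (Sum.inrₗ i) (by rintro ⟨a, ha⟩; exact Sum.inl_ne_inr ha)
    rw [← hC₀] at hker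
    obtain ⟨t, rfl⟩ := (Submodule.mem_span_range_iff_exists_fun _).1 hker
    refine ⟨fun j => MvPolynomial.map φ (t j), funext fun i => ?_⟩
    change MvPolynomial.map φ ((∑ j, t j • C₀ j) i) = _
    simp [Matrix.mulVec, dotProduct, mul_comm]
  | zero => exact ⟨0, (Matrix.mulVec_zero _).symm⟩
  | add a b _ _ ha hb =>
    obtain ⟨s, hs⟩ := ha
    obtain ⟨t, ht⟩ := hb
    exact ⟨s + t, by rw [Matrix.mulVec_add, ← hs, ← ht]; rfl⟩
  | smul a b _ hb =>
    obtain ⟨t, ht⟩ := hb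
    exact ⟨a • t, by rw [Matrix.mulVec_smul, ← ht]; rfl⟩

/-- A nonzerodivisor modulo an ideal `Q` of `A[X]` stays one after specialization of the
coefficients, outside the zero locus of some nonzero `c`. -/
theorem exists_ne_zero_mem_map_of_mul_mem {σ A : Type} [Finite σ] [CommRing A] [IsDomain A]
    [IsNoetherianRing A] (Q : Ideal (MvPolynomial σ A)) (g : MvPolynomial σ A)
    (hg : ∀ x, g * x ∈ Q → x ∈ Q) :
    ∃ c : A, c ≠ 0 ∧ ∀ (F : Type) [Field F] (φ : A →+* F), φ c ≠ 0 →
      ∀ x, MvPolynomial.map φ g * x ∈ Q.map (MvPolynomial.map φ) →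
        x ∈ Q.map (MvPolynomial.map φ) := by
  obtain ⟨r, f, rfl⟩ := Submodule.fg_iff_exists_fin_generating_family.1
    (IsNoetherian.noetherian Q)
  obtain ⟨s, C, hBC, c, hc, hker⟩ := exists_ne_zero_ker_specialization
    (Matrix.of fun (_ : Unit) (j : Option (Fin r)) => j.elim g f)
  refine ⟨c, hc, fun F _ φ hφ x hx => ?_⟩
  have hmap : Ideal.map (MvPolynomial.map φ) (Submodule.span (MvPolynomial σ A) (Set.range f)) =
       Ideal.span (Set.range fun i => MvPolynomial.map φ (f i)) := by
    change Ideal.map _ (Ideal.span _) = _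
    rw [Ideal.map_span, ← Set.range_comp]
    rfl
  rw [hmap] at hx
  obtain ⟨t, ht⟩ := (Submodule.mem_span_range_iff_exists_fun _).1 hx
  obtain ⟨y, hy⟩ := hker F φ hφ (fun j => j.elim x fun i => - t i) (by
    ext1 i
    simp only [smul_eq_mul] at ht
    have h0 : MvPolynomial.map φ g * x + ∑ i, MvPolynomial.map φ (f i) * -t i = 0 := by
      simp only [← ht, mul_neg, Finset.sum_neg_distrib, mul_comm (t _), add_neg_cancel]
    change ∑ j : Option (Fin r), MvPolynomial.map φ (j.elim g f) * j.elim x (fun i => - t i) = 0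
    rw [Fintype.sum_option]
    exact h0)
  have hx' : x = ∑ j, MvPolynomial.map φ (C none j) * y j := congrFun hy none
  rw [hx']
  refine Ideal.sum_mem _ fun j _ => Ideal.mul_mem_right _ _ (Ideal.mem_map_of_mem _ (hg _ ?_))
  have h0 := congrFun (congrFun hBC ()) j
  simp only [Matrix.mul_apply, Fintype.sum_option, Matrix.of_apply, Option.elim,
    Matrix.zero_apply] at h0
  rw [eq_neg_of_add_eq_zero_left h0]
  exact neg_mem (Ideal.sum_mem _ fun i _ => Ideal.mul_mem_right _ _
    (Submodule.subset_span ⟨i, rfl⟩))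

section FractionSpecialization

variable {D S T : Type} [CommRing D] [CommRing S] [CommRing T]

/-- `b : T` is the specialization of `a : S`: there is a fraction `p / g` over `D` which equals
`a` in `S` and `b` in `T`, with `g` invertible in `T`. -/
def FracSpec (i : D →+* S) (j : D →+* T) (a : S) (b : T) : Prop :=
  ∃ p g : D, IsUnit (j g) ∧ i g * a = i p ∧ j g * b = j p

namespace FracSpec

variable {i : D →+* S} {j : D →+* T}

theorem eq (hi : Function.Injective i) {a : S} {b b' : T} (h : FracSpec i j a b)
    (h' : FracSpec i j a b') : b = b' := by
  obtain ⟨p, g, hg, h1, h2⟩ := h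
  obtain ⟨p', g', hg', h1', h2'⟩ := h'
  have h3 : p * g' = p' * g := hi (by rw [map_mul, map_mul, ← h1, ← h1']; ring)
  have h4 : j p * j g' = j p' * j g := by rw [← map_mul, ← map_mul, h3]
  refine (hg.mul hg').mul_left_cancel ?_
  linear_combination j g' * h2 - j g * h2' + h4

theorem of (d : D) : FracSpec i j (i d) (j d) := ⟨d, 1, by simp, by simp, by simp⟩

theorem zero : FracSpec i j 0 0 := by simpa using of (i := i) (j := j) 0

theorem one : FracSpec i j 1 1 := by simpa using of (i := i) (j := j) 1

theorem add {a a' : S} {b b' : T} (h : FracSpec i j a b) (h' : FracSpec i j a' b') :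
    FracSpec i j (a + a') (b + b') := by
  obtain ⟨p, g, hg, h1, h2⟩ := h
  obtain ⟨p', g', hg', h1', h2'⟩ := h'
  refine ⟨p * g' + p' * g, g * g', by rw [map_mul]; exact hg.mul hg', ?_, ?_⟩
  · simp only [map_mul, map_add]
    linear_combination i g' * h1 + i g * h1'
  · simp only [map_mul, map_add]
    linear_combination j g' * h2 + j g * h2'

theorem mul {a a' : S} {b b' : T} (h : FracSpec i j a b) (h' : FracSpec i j a' b') :
    FracSpec i j (a * a') (b * b') := by
  obtain ⟨p, g, hg, h1, h2⟩ := h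
  obtain ⟨p', g', hg', h1', h2'⟩ := h'
  refine ⟨p * p', g * g', by rw [map_mul]; exact hg.mul hg', ?_, ?_⟩
  · simp only [map_mul, ← h1, ← h1']
    ring
  · simp only [map_mul, ← h2, ← h2']
    ring

theorem neg {a : S} {b : T} (h : FracSpec i j a b) : FracSpec i j (-a) (-b) := by
  obtain ⟨p, g, hg, h1, h2⟩ := h
  exact ⟨-p, g, hg, by simp [h1], by simp [h2]⟩

theorem sum {ι : Type} (s : Finset ι) {a : ι → S} {b : ι → T}
    (h : ∀ x, FracSpec i j (a x) (b x)) : FracSpec i j (∑ x ∈ s, a x) (∑ x ∈ s, b x) := by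
  classical
  induction s using Finset.induction_on with
  | empty => simpa using zero
  | insert x s hx ih =>
    rw [Finset.sum_insert hx, Finset.sum_insert hx]
    exact (h x).add ih

theorem exists_of_isUnit {a : S} {p g : D} (hg : IsUnit (j g)) (h : i g * a = i p) :
    ∃ b, FracSpec i j a b := by
  obtain ⟨u, hu⟩ := hg
  exact ⟨↑u⁻¹ * j p, p, g, ⟨u, hu⟩, h, by rw [← hu, Units.mul_inv_cancel_left]⟩

end FracSpec

/-- Entrywise specialization of matrices of fractions. -/
def MatFracSpec {ι κ : Type} (i : D →+* S) (j : D →+* T) (M : Matrix ι κ S) (M' : Matrix ι κ T) :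
    Prop := ∀ x y, FracSpec i j (M x y) (M' x y)

namespace MatFracSpec

variable {i : D →+* S} {j : D →+* T} {ι κ μ : Type}

theorem eq (hi : Function.Injective i) {M : Matrix ι κ S} {M' M'' : Matrix ι κ T}
    (h : MatFracSpec i j M M') (h' : MatFracSpec i j M M'') : M' = M'' :=
  Matrix.ext fun x y => (h x y).eq hi (h' x y)

theorem of (M : Matrix ι κ D) : MatFracSpec i j (M.map i) (M.map j) := fun _ _ => FracSpec.of _

theorem one [DecidableEq ι] : MatFracSpec i j (1 : Matrix ι ι S) 1 := by
  intro x y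
  rw [Matrix.one_apply, Matrix.one_apply]
  split_ifs
  exacts [FracSpec.one, FracSpec.zero]

theorem mul [Fintype κ] {M : Matrix ι κ S} {M' : Matrix ι κ T} {N : Matrix κ μ S}
    {N' : Matrix κ μ T} (h : MatFracSpec i j M M') (h' : MatFracSpec i j N N') :
    MatFracSpec i j (M * N) (M' * N') := fun x y => by
  rw [Matrix.mul_apply, Matrix.mul_apply]
  exact FracSpec.sum _ fun z => (h x z).mul (h' z y)

theorem add {M N : Matrix ι κ S} {M' N' : Matrix ι κ T} (h : MatFracSpec i j M M')
    (h' : MatFracSpec i j N N') : MatFracSpec i j (M + N) (M' + N') :=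
  fun x y => (h x y).add (h' x y)

theorem fromCols_neg {M : Matrix ι κ S} {M' : Matrix ι κ T} {N : Matrix ι μ S} {N' : Matrix ι μ T}
    (h : MatFracSpec i j M M') (h' : MatFracSpec i j N N') :
    MatFracSpec i j (Matrix.fromCols M (-N)) (Matrix.fromCols M' (-N')) := by
  rintro x (y | y)
  exacts [h x y, (h' x y).neg]

end MatFracSpec

/-- Finitely many elements of `S` have a common denominator. -/
theorem exists_common_denom {i : D →+* S} (hden : ∀ a, ∃ g p, IsUnit (i g) ∧ i g * a = i p)
    {ι κ : Type} [Fintype ι] [Fintype κ] (M : Matrix ι κ S) :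
    ∃ (g : D) (M₀ : Matrix ι κ D), IsUnit (i g) ∧ i g • M = M₀.map i := by
  classical
  choose g p hg hp using fun x : ι × κ => hden (M x.1 x.2)
  refine ⟨∏ x, g x, Matrix.of fun x y => (∏ z ∈ Finset.univ.erase (x, y), g z) * p (x, y), ?_, ?_⟩
  · rw [map_prod]
    exact IsUnit.prod_univ_iff.2 hg
  · ext1 x y
    simp only [Matrix.smul_apply, smul_eq_mul, Matrix.map_apply, Matrix.of_apply, map_mul, ← hp]
    rw [← Finset.prod_erase_mul _ _ (Finset.mem_univ (x, y)), map_mul, mul_assoc]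

theorem MatFracSpec.exists_of_isUnit {i : D →+* S} {j : D →+* T} {ι κ : Type} {M : Matrix ι κ S}
    {M₀ : Matrix ι κ D} {g : D} (hg : IsUnit (j g)) (h : i g • M = M₀.map i) :
    ∃ M', MatFracSpec i j M M' := by
  choose M' hM' using fun x y =>
    FracSpec.exists_of_isUnit (i := i) hg (congrFun (congrFun h x) y)
  exact ⟨M', hM'⟩

theorem exists_factor {ι κ μ : Type} [Fintype κ] [Fintype μ] {X : Matrix ι κ S} {Y : Matrix ι μ S}
    (h : ∀ x, ∃ y, X.mulVec x = Y.mulVec y) : ∃ Z : Matrix μ κ S, X = Y * Z := by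
  classical
  choose z hz using fun l => h (Pi.single l 1)
  refine ⟨Matrix.of fun a l => z l a, Matrix.ext fun a l => ?_⟩
  have := congrFun (hz l) a
  rw [Matrix.mulVec_single_one] at this
  exact this

end FractionSpecialization

/-- Matrix identities that force exactness of the sequence of cokernels. -/
theorem exact_cokerMap {T : Type} [CommRing T] {rL sL rM sM rN sN : ℕ}
    {BL : Matrix (Fin rL) (Fin sL) T} {BM : Matrix (Fin rM) (Fin sM) T}
    {BN : Matrix (Fin rN) (Fin sN) T} {V0 : Matrix (Fin rM) (Fin rL) T}
    {V1 : Matrix (Fin sM) (Fin sL) T} {W0 : Matrix (Fin rN) (Fin rM) T}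
    {W1 : Matrix (Fin sN) (Fin sM) T}
    (h1 : V0 * BL = BM * V1) (h2 : W0 * BM = BN * W1)
    (hinj : ∀ x y, V0.mulVec x = BM.mulVec y → ∃ z, x = BL.mulVec z)
    {X : Matrix (Fin rM) (Fin rN) T} {Y : Matrix (Fin sN) (Fin rN) T} (hXY : W0 * X = 1 + BN * Y)
    {Z : Matrix (Fin rL ⊕ Fin sM) (Fin rM) T} (hZ : X * W0 = 1 + Matrix.fromCols V0 (-BM) * Z)
    {Z' : Matrix (Fin rL ⊕ Fin sM) (Fin sN) T} (hZ' : X * BN = Matrix.fromCols V0 (-BM) * Z')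
    {U : Matrix (Fin sN) (Fin rL) T} (hU : W0 * V0 = BN * U) :
    Function.Injective (cokerMap V0 (comm_le h1)) ∧
      LinearMap.range (cokerMap V0 (comm_le h1)) = LinearMap.ker (cokerMap W0 (comm_le h2)) ∧
      Function.Surjective (cokerMap W0 (comm_le h2)) := by
  refine ⟨?_, le_antisymm ?_ ?_, ?_⟩
  · rw [← LinearMap.ker_eq_bot, eq_bot_iff]
    intro x hx
    obtain ⟨x, rfl⟩ := Submodule.Quotient.mk_surjective _ x
    obtain ⟨y, hy⟩ := (Submodule.Quotient.mk_eq_zero _).1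
      (show Submodule.Quotient.mk (V0.mulVec x) = 0 from hx)
    obtain ⟨z, rfl⟩ := hinj x y hy.symm
    exact (Submodule.Quotient.mk_eq_zero _).2 ⟨z, rfl⟩
  · rintro _ ⟨x, rfl⟩
    obtain ⟨x, rfl⟩ := Submodule.Quotient.mk_surjective _ x
    refine (Submodule.Quotient.mk_eq_zero _).2 ⟨U.mulVec x, ?_⟩
    change BN.mulVec (U.mulVec x) = W0.mulVec (V0.mulVec x)
    rw [Matrix.mulVec_mulVec, Matrix.mulVec_mulVec, hU]
  · intro x hx
    obtain ⟨x, rfl⟩ := Submodule.Quotient.mk_surjective _ x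
    obtain ⟨y, hy⟩ := (Submodule.Quotient.mk_eq_zero _).1
      (show Submodule.Quotient.mk (W0.mulVec x) = 0 from hx)
    replace hy : BN.mulVec y = W0.mulVec x := hy
    set t := Z'.mulVec y - Z.mulVec x with ht
    have hx' : x = (Matrix.fromCols V0 (-BM)).mulVec t := by
      rw [ht, Matrix.mulVec_sub, Matrix.mulVec_mulVec, Matrix.mulVec_mulVec, ← hZ',
        ← Matrix.mulVec_mulVec, hy, Matrix.mulVec_mulVec, hZ, Matrix.add_mulVec, Matrix.one_mulVec,
        add_sub_cancel_right]
    refine ⟨Submodule.Quotient.mk (t ∘ Sum.inl), (Submodule.Quotient.eq _).2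
      ⟨(t ∘ Sum.inr), ?_⟩⟩
    change BM.mulVec (t ∘ Sum.inr) = V0.mulVec (t ∘ Sum.inl) - x
    rw [Matrix.fromCols_mulVec, Matrix.neg_mulVec] at hx'
    rw [hx']
    abel
  · intro y
    obtain ⟨y, rfl⟩ := Submodule.Quotient.mk_surjective _ y
    refine ⟨Submodule.Quotient.mk (X.mulVec y), (Submodule.Quotient.eq _).2 ⟨Y.mulVec y, ?_⟩⟩
    change BN.mulVec (Y.mulVec y) = W0.mulVec (X.mulVec y) - y
    rw [Matrix.mulVec_mulVec, Matrix.mulVec_mulVec, hXY, Matrix.add_mulVec, Matrix.one_mulVec,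
      add_sub_cancel_left]

theorem Present.exists_of_π_eq_zero {S L : Type} [CommRing S] [AddCommGroup L] [Module S L]
    {r s : ℕ} (p : Present S r s L) {x : Fin r → S} (hx : p.π x = 0) :
    ∃ y, x = p.A.mulVec y := by
  have : x ∈ LinearMap.range p.A.mulVecLin := p.ker_eq ▸ hx
  obtain ⟨y, rfl⟩ := this
  exact ⟨y, rfl⟩

theorem Present.π_mulVec {S L : Type} [CommRing S] [AddCommGroup L] [Module S L]
    {r s : ℕ} (p : Present S r s L) (y : Fin s → S) : p.π (p.A.mulVec y) = 0 := by
  have : p.A.mulVec y ∈ LinearMap.ker p.π := p.ker_eq ▸ ⟨y, rfl⟩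
  exact this

section ShortExact

variable {S L M N : Type} [CommRing S] [AddCommGroup L] [Module S L]
  [AddCommGroup M] [Module S M] [AddCommGroup N] [Module S N] {v : L →ₗ[S] M} {w : M →ₗ[S] N}
  {rL sL rM sM rN sN : ℕ} {pL : Present S rL sL L} {pM : Present S rM sM M}
  {pN : Present S rN sN N}

theorem MapLift.π_mulVec (lv : MapLift pL pM v) (x : Fin rL → S) :
    pM.π (lv.V0.mulVec x) = v (pL.π x) := LinearMap.congr_fun lv.comm0 x

/-- An exact sequence yields matrix identities as in `exact_cokerMap`. -/
theorem exists_matrix_identities (lv : MapLift pL pM v) (lw : MapLift pM pN w)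
    (hvw : LinearMap.range v = LinearMap.ker w) (hw : Function.Surjective w) :
    ∃ (X : Matrix (Fin rM) (Fin rN) S) (Y : Matrix (Fin sN) (Fin rN) S)
      (Z : Matrix (Fin rL ⊕ Fin sM) (Fin rM) S) (Z' : Matrix (Fin rL ⊕ Fin sM) (Fin sN) S)
      (U : Matrix (Fin sN) (Fin rL) S), lw.V0 * X = 1 + pN.A * Y ∧
      X * lw.V0 = 1 + Matrix.fromCols lv.V0 (-pM.A) * Z ∧
      X * pN.A = Matrix.fromCols lv.V0 (-pM.A) * Z' ∧ lw.V0 * lv.V0 = pN.A * U := by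
  have hker : ∀ x, w (pM.π x) = 0 → ∃ t, x = (Matrix.fromCols lv.V0 (-pM.A)).mulVec t := by
    intro x hx
    obtain ⟨l, hl⟩ : pM.π x ∈ LinearMap.range v := hvw ▸ hx
    obtain ⟨a, rfl⟩ := pL.surj l
    obtain ⟨b, hb⟩ := pM.exists_of_π_eq_zero (x := x - lv.V0.mulVec a) (by
      rw [map_sub, lv.π_mulVec, hl, sub_self])
    refine ⟨Sum.elim a (-b), ?_⟩
    rw [Matrix.fromCols_mulVec, Sum.elim_comp_inl, Sum.elim_comp_inr, Matrix.neg_mulVec,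
      Matrix.mulVec_neg, neg_neg, ← hb, add_sub_cancel]
  have hX : ∃ X : Matrix (Fin rM) (Fin rN) S, ∀ x, w (pM.π (X.mulVec x)) = pN.π x := by
    choose m hm using fun j : Fin rN => hw (pN.π (Pi.single j 1))
    choose t ht using fun j => pM.surj (m j)
    refine ⟨Matrix.of fun a j => t j a, fun x => ?_⟩
    suffices w ∘ₗ pM.π ∘ₗ (Matrix.of fun a j => t j a).mulVecLin = pN.π from
      LinearMap.congr_fun this x
    refine LinearMap.pi_ext' fun j => LinearMap.ext_ring ?_
    change w (pM.π ((Matrix.of fun a j => t j a).mulVec (Pi.single j 1))) = pN.π (Pi.single j 1)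
    rw [Matrix.mulVec_single_one, ← hm, ← ht]
    rfl
  obtain ⟨X, hX⟩ := hX
  obtain ⟨Y, hY⟩ := exists_factor (X := lw.V0 * X - 1) (Y := pN.A) fun x =>
    pN.exists_of_π_eq_zero (by
      rw [Matrix.sub_mulVec, ← Matrix.mulVec_mulVec, map_sub, lw.π_mulVec, hX, Matrix.one_mulVec,
        sub_self])
  obtain ⟨Z, hZ⟩ := exists_factor (X := X * lw.V0 - 1) (Y := Matrix.fromCols lv.V0 (-pM.A))
    fun x => hker _ (by
      rw [Matrix.sub_mulVec, ← Matrix.mulVec_mulVec, map_sub, map_sub, hX, lw.π_mulVec,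
        Matrix.one_mulVec, sub_self])
  obtain ⟨Z', hZ'⟩ := exists_factor (X := X * pN.A) (Y := Matrix.fromCols lv.V0 (-pM.A))
    fun x => hker _ (by rw [← Matrix.mulVec_mulVec, hX, pN.π_mulVec])
  obtain ⟨U, hU⟩ := exists_factor (X := lw.V0 * lv.V0) (Y := pN.A) fun x =>
    pN.exists_of_π_eq_zero (by
      rw [← Matrix.mulVec_mulVec, lw.π_mulVec, lv.π_mulVec]
      exact (hvw ▸ LinearMap.mem_range_self v (pL.π x) : v (pL.π x) ∈ LinearMap.ker w))
  exact ⟨X, Y, Z, Z', U, by rw [← hY, add_sub_cancel], by rw [← hZ, add_sub_cancel], hZ', hU⟩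

/-- Exactness of the specialized sequence for a pair of ring maps `i : D → S`, `j : D → T`, where
`S` consists of fractions over `D`: it suffices that `j` inverts one denominator `g` and
preserves exactness of one complex of free `D`-modules. -/
theorem exists_denom_forall_exact {D : Type} [CommRing D] {i : D →+* S}
    (hi : Function.Injective i) (hden : ∀ a, ∃ g p, IsUnit (i g) ∧ i g * a = i p)
    (lv : MapLift pL pM v) (lw : MapLift pM pN w) (hv : Function.Injective v)
    (hvw : LinearMap.range v = LinearMap.ker w) (hw : Function.Surjective w) :
    ∃ B₀ : Matrix (Fin rM) (Fin rL ⊕ Fin sM) D,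
      ∀ (r : ℕ) (C₀ : Matrix (Fin rL ⊕ Fin sM) (Fin r) D), B₀ * C₀ = 0 →
      ∃ g : D, IsUnit (i g) ∧ ∀ (T : Type) [CommRing T] (j : D →+* T), IsUnit (j g) →
        (∀ x, (B₀.map j).mulVec x = 0 → ∃ y, x = (C₀.map j).mulVec y) →
        ∀ (BL : Matrix (Fin rL) (Fin sL) T) (BM : Matrix (Fin rM) (Fin sM) T)
          (BN : Matrix (Fin rN) (Fin sN) T)
          (V0 : Matrix (Fin rM) (Fin rL) T) (V1 : Matrix (Fin sM) (Fin sL) T)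
          (W0 : Matrix (Fin rN) (Fin rM) T) (W1 : Matrix (Fin sN) (Fin sM) T),
          MatFracSpec i j pL.A BL → MatFracSpec i j pM.A BM → MatFracSpec i j pN.A BN →
          MatFracSpec i j lv.V0 V0 → MatFracSpec i j lv.V1 V1 →
          MatFracSpec i j lw.V0 W0 → MatFracSpec i j lw.V1 W1 →
          ∃ (h1 : V0 * BL = BM * V1) (h2 : W0 * BM = BN * W1),
            Function.Injective (cokerMap V0 (comm_le h1)) ∧
            LinearMap.range (cokerMap V0 (comm_le h1)) =
              LinearMap.ker (cokerMap W0 (comm_le h2)) ∧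
            Function.Surjective (cokerMap W0 (comm_le h2)) := by
  obtain ⟨g₀, B₀, hg₀, hB₀⟩ := exists_common_denom hden (Matrix.fromCols lv.V0 (-pM.A))
  refine ⟨B₀, fun r C₀ hBC => ?_⟩
  obtain ⟨X, Y, Z, Z', U, hXY, hZ, hZ', hU⟩ := exists_matrix_identities lv lw hvw hw
  have hBC' : Matrix.fromCols lv.V0 (-pM.A) * C₀.map i = 0 := by
    have h : i g₀ • (Matrix.fromCols lv.V0 (-pM.A) * C₀.map i) = 0 := by
      rw [← Matrix.smul_mul, hB₀, ← Matrix.map_mul, hBC, Matrix.map_zero _ (map_zero i)]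
    exact hg₀.smul_eq_zero.1 h
  obtain ⟨E, hE⟩ := exists_factor (X := (C₀.submatrix Sum.inl id).map i) (Y := pL.A) fun x =>
    pL.exists_of_π_eq_zero (hv (by
      have h := congrArg (fun Q => pM.π (Q.mulVec x)) hBC'
      simp only [Matrix.zero_mulVec, map_zero] at h
      rw [← Matrix.mulVec_mulVec, Matrix.fromCols_mulVec, Matrix.neg_mulVec, map_add, map_neg,
        pM.π_mulVec, neg_zero, add_zero, lv.π_mulVec] at h
      rw [map_zero]
      exact h))
  obtain ⟨gX, X₀, hgX, hX₀⟩ := exists_common_denom hden X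
  obtain ⟨gY, Y₀, hgY, hY₀⟩ := exists_common_denom hden Y
  obtain ⟨gZ, Z₀, hgZ, hZ₀⟩ := exists_common_denom hden Z
  obtain ⟨gZ', Z'₀, hgZ', hZ'₀⟩ := exists_common_denom hden Z'
  obtain ⟨gU, U₀, hgU, hU₀⟩ := exists_common_denom hden U
  obtain ⟨gE, E₀, hgE, hE₀⟩ := exists_common_denom hden E
  refine ⟨g₀ * gX * gY * gZ * gZ' * gU * gE, ?_, ?_⟩
  · simp only [map_mul]
    exact (((((hg₀.mul hgX).mul hgY).mul hgZ).mul hgZ').mul hgU).mul hgE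
  intro T _ j hj hker BL BM BN V0 V1 W0 W1 hBL hBM hBN hV0 hV1 hW0 hW1
  simp only [map_mul, IsUnit.mul_iff] at hj
  obtain ⟨⟨⟨⟨⟨⟨hj₀, hjX⟩, hjY⟩, hjZ⟩, hjZ'⟩, hjU⟩, hjE⟩ := hj
  obtain ⟨X', hX'⟩ := MatFracSpec.exists_of_isUnit hjX hX₀
  obtain ⟨Y', hY'⟩ := MatFracSpec.exists_of_isUnit hjY hY₀
  obtain ⟨Zα, hZα⟩ := MatFracSpec.exists_of_isUnit hjZ hZ₀
  obtain ⟨Zα', hZα'⟩ := MatFracSpec.exists_of_isUnit hjZ' hZ'₀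
  obtain ⟨U', hU'⟩ := MatFracSpec.exists_of_isUnit hjU hU₀
  obtain ⟨E', hE'⟩ := MatFracSpec.exists_of_isUnit hjE hE₀
  have hVM := hV0.fromCols_neg hBM
  have hB₀' : j g₀ • Matrix.fromCols V0 (-BM) = B₀.map j :=
    MatFracSpec.eq hi (M := i g₀ • Matrix.fromCols lv.V0 (-pM.A))
      (fun x y => (FracSpec.of g₀).mul (hVM x y)) (hB₀ ▸ MatFracSpec.of B₀)
  have hCE : (C₀.submatrix Sum.inl id).map j = BL * E' :=
    MatFracSpec.eq hi (MatFracSpec.of _) (hE ▸ hBL.mul hE')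
  have h1 : V0 * BL = BM * V1 := MatFracSpec.eq hi (hV0.mul hBL) (lv.comm1 ▸ hBM.mul hV1)
  have h2 : W0 * BM = BN * W1 := MatFracSpec.eq hi (hW0.mul hBM) (lw.comm1 ▸ hBN.mul hW1)
  refine ⟨h1, h2, exact_cokerMap h1 h2 ?_
      (MatFracSpec.eq hi (hW0.mul hX') (hXY ▸ MatFracSpec.one.add (hBN.mul hY')))
      (MatFracSpec.eq hi (hX'.mul hW0) (hZ ▸ MatFracSpec.one.add (hVM.mul hZα)))
      (MatFracSpec.eq hi (hX'.mul hBN) (hZ' ▸ hVM.mul hZα'))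
      (MatFracSpec.eq hi (hW0.mul hV0) (hU ▸ hBN.mul hU'))⟩
  intro x y hxy
  obtain ⟨t, ht⟩ := hker (Sum.elim x y) (by
    rw [← hB₀', Matrix.smul_mulVec, Matrix.fromCols_mulVec, Sum.elim_comp_inl, Sum.elim_comp_inr,
      Matrix.neg_mulVec, hxy, add_neg_cancel, smul_zero])
  refine ⟨E'.mulVec t, ?_⟩
  rw [Matrix.mulVec_mulVec, ← hCE]
  exact funext fun a => congrFun ht (Sum.inl a)

end ShortExact

/-- Solvability of homogeneous linear systems in terms of a fixed matrix passes to localizations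
of a domain. -/
theorem ker_mulVec_localization {R T : Type} [CommRing R] [IsDomain R] (p : Ideal R) [p.IsPrime]
    [CommRing T] [Algebra R T] [IsLocalization.AtPrime T p] {ι κ μ : Type} [Fintype κ] [Fintype μ]
    {B : Matrix ι κ R} {C : Matrix κ μ R}
    (h : ∀ x, B.mulVec x = 0 → ∃ y, x = C.mulVec y) (x : κ → T)
    (hx : (B.map (algebraMap R T)).mulVec x = 0) :
    ∃ y, x = (C.map (algebraMap R T)).mulVec y := by
  obtain ⟨s, hs⟩ := IsLocalization.exist_integer_multiples_of_finite p.primeCompl x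
  choose x₀ hx₀ using hs
  have hinj : Function.Injective (algebraMap R T) :=
    IsLocalization.injective T p.primeCompl_le_nonZeroDivisors
  have hx₀' : (fun a => algebraMap R T (x₀ a)) = algebraMap R T s • x :=
    funext fun a => (hx₀ a).trans (Algebra.smul_def _ _)
  obtain ⟨y, rfl⟩ := h x₀ (funext fun a => hinj (by
    refine (RingHom.map_mulVec (algebraMap R T) B x₀ a).trans ?_
    change (B.map (algebraMap R T)).mulVec (fun a => algebraMap R T (x₀ a)) a = _
    rw [hx₀', Matrix.mulVec_smul, hx, smul_zero, Pi.zero_apply, Pi.zero_apply, map_zero]))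
  obtain ⟨u, hu⟩ := IsLocalization.map_units T s
  refine ⟨(↑u⁻¹ : T) • fun a => algebraMap R T (y a), ?_⟩
  rw [Matrix.mulVec_smul]
  have : (C.map (algebraMap R T)).mulVec (fun a => algebraMap R T (y a)) = (u : T) • x := by
    rw [hu, ← hx₀']
    exact funext fun a => (RingHom.map_mulVec (algebraMap R T) C y a).symm
  rw [this, smul_smul, Units.inv_mul, one_smul]

theorem toR_injective (k : Type) [Field k] (m n : ℕ) : Function.Injective (toR k m n) :=
  MvPolynomial.map_injective _ (IsFractionRing.injective _ _)

theorem almostAll_evalα_ne_zero {k K : Type} [Field k] [Field K] [Algebra k K] {m : ℕ}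
    {c : MvPolynomial (Fin m) k} (hc : c ≠ 0) :
    AlmostAll K m fun α => evalα k K α c ≠ 0 := by
  refine ⟨MvPolynomial.map (algebraMap k K) c, ?_, fun α hα h => hα ?_⟩
  · rwa [Ne, map_eq_zero_iff _ (MvPolynomial.map_injective _ (algebraMap k K).injective)]
  · rw [MvPolynomial.eval_map, ← MvPolynomial.aeval_def]
    refine (MvPolynomial.aeval_algebraMap_apply K (fun i =>
      (⟨α i, IntermediateField.subset_adjoin k (Set.range α) ⟨i, rfl⟩⟩ : kA k K α)) c).trans ?_
    exact (congrArg (algebraMap (kA k K α) K) h).trans (map_zero _)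

theorem exists_denom_toR {k : Type} [Field k] {m n : ℕ} (f : Rg k m n) :
    ∃ q : MvPolynomial (Fin m) k, q ≠ 0 ∧ ∃ p,
      MvPolynomial.C (algebraMap (MvPolynomial (Fin m) k) (kU k m) q) * f = toR k m n p := by
  induction f using MvPolynomial.induction_on with
  | C a =>
    obtain ⟨p, q, hq, rfl⟩ := IsFractionRing.div_surjective (MvPolynomial (Fin m) k) a
    have hq' := nonZeroDivisors.ne_zero hq
    refine ⟨q, hq', MvPolynomial.C p, ?_⟩
    rw [toR, MvPolynomial.map_C, ← map_mul, mul_div_cancel₀]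
    rwa [Ne, map_eq_zero_iff _ (IsFractionRing.injective _ _)]
  | add f f' hf hf' =>
    obtain ⟨q, hq, p, hp⟩ := hf
    obtain ⟨q', hq', p', hp'⟩ := hf'
    refine ⟨q * q', mul_ne_zero hq hq', MvPolynomial.C q' * p + MvPolynomial.C q * p', ?_⟩
    simp only [map_add, map_mul, ← hp, ← hp']
    simp only [toR, MvPolynomial.map_C]
    ring
  | mul_X f i hf =>
    obtain ⟨q, hq, p, hp⟩ := hf
    refine ⟨q, hq, p * MvPolynomial.X i, ?_⟩
    rw [map_mul, ← hp, toR, MvPolynomial.map_X, mul_assoc]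

theorem isUnit_C_algebraMap {k : Type} [Field k] {m n : ℕ} {q : MvPolynomial (Fin m) k}
    (hq : q ≠ 0) :
    IsUnit (MvPolynomial.C (algebraMap (MvPolynomial (Fin m) k) (kU k m) q) : Rg k m n) := by
  refine IsUnit.map _ (IsUnit.mk0 _ ?_)
  rwa [Ne, map_eq_zero_iff _ (IsFractionRing.injective _ _)]

section Local

variable {k K : Type} [Field k] [Field K] [Algebra k K] {m n : ℕ}

theorem exists_denom_algebraMap_toR (P : Ideal (Rg k m n)) [P.IsPrime] {S : Type} [CommRing S]
    [Algebra (Rg k m n) S] [IsLocalization.AtPrime S P] (a : S) :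
    ∃ g p, IsUnit ((algebraMap (Rg k m n) S).comp (toR k m n) g) ∧
      (algebraMap (Rg k m n) S).comp (toR k m n) g * a =
        (algebraMap (Rg k m n) S).comp (toR k m n) p := by
  obtain ⟨⟨f, s⟩, hs⟩ := IsLocalization.surj P.primeCompl a
  obtain ⟨q, hq, p, hp⟩ := exists_denom_toR f
  obtain ⟨q', hq', g, hg⟩ := exists_denom_toR s.1
  refine ⟨MvPolynomial.C q * g, MvPolynomial.C q' * p, ?_, ?_⟩
  · rw [RingHom.comp_apply, map_mul, map_mul, ← hg, map_mul]
    refine IsUnit.mul ?_ (((isUnit_C_algebraMap hq').map _).mul (IsLocalization.map_units S s))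
    rw [toR, MvPolynomial.map_C]
    exact (isUnit_C_algebraMap hq).map _
  · simp only [RingHom.comp_apply, map_mul, ← hg, ← hp]
    simp only [toR, MvPolynomial.map_C] at hs ⊢
    rw [← hs]
    ring

theorem algebraMap_comp_toR_injective (P : Ideal (Rg k m n)) [P.IsPrime] {S : Type} [CommRing S]
    [Algebra (Rg k m n) S] [IsLocalization.AtPrime S P] :
    Function.Injective ((algebraMap (Rg k m n) S).comp (toR k m n)) :=
  (IsLocalization.injective S P.primeCompl_le_nonZeroDivisors).comp (toR_injective k m n)

theorem LocElemSpec.fracSpec {P : Ideal (Rg k m n)} [P.IsPrime] {S : Type} [CommRing S]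
    [Algebra (Rg k m n) S] [IsLocalization.AtPrime S P] {α : Fin m → K}
    {p : Ideal (Ra k K n α)} [p.IsPrime]
    {T : Type} [CommRing T] [Algebra (Ra k K n α) T] [IsLocalization.AtPrime T p]
    {a : S} {b : T} (h : LocElemSpec P p a b) :
    FracSpec ((algebraMap (Rg k m n) S).comp (toR k m n))
      ((algebraMap (Ra k K n α) T).comp (toRa k K n α)) a b := by
  obtain ⟨f, g, fα, gα, hg, hgα, ⟨pf, qf, hqf, hf, hfα⟩, ⟨pg, qg, hqg, hg', hgα'⟩, rfl, rfl⟩ := h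
  have hunit {q : MvPolynomial (Fin m) k} (hq : evalα k K α q ≠ 0) :
      IsUnit (algebraMap (Ra k K n α) T (MvPolynomial.C (evalα k K α q))) :=
    ((IsUnit.mk0 _ hq).map MvPolynomial.C).map _
  refine ⟨MvPolynomial.C qg * pf, MvPolynomial.C qf * pg, ?_, ?_, ?_⟩
  · rw [RingHom.comp_apply, map_mul, map_mul, ← hgα', map_mul]
    refine IsUnit.mul ?_ ((hunit hqg).mul (IsLocalization.map_units T ⟨gα, hgα⟩))
    rw [toRa, MvPolynomial.map_C]
    exact hunit hqf
  · have h := IsLocalization.mk'_spec' S f ⟨g, hg⟩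
    simp only [RingHom.comp_apply, map_mul, ← hf, ← hg']
    simp only [toR, MvPolynomial.map_C] at h ⊢
    rw [← h]
    ring
  · have h := IsLocalization.mk'_spec' T fα ⟨gα, hgα⟩
    simp only [RingHom.comp_apply, map_mul, ← hfα, ← hgα']
    simp only [toRa, MvPolynomial.map_C] at h ⊢
    rw [← h]
    ring

/-- An element of `k[u, X]` outside `P` specializes outside all associated primes of `P_α`, for
almost all `α`. -/
theorem exists_ne_zero_toRa_notMem (P : Ideal (Rg k m n)) [P.IsPrime]
    {g : MvPolynomial (Fin n) (MvPolynomial (Fin m) k)}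
    (hg : toR k m n g ∉ P) :
    ∃ c : MvPolynomial (Fin m) k, c ≠ 0 ∧ ∀ α : Fin m → K, evalα k K α c ≠ 0 →
      ∀ p : Ideal (Ra k K n α), IsAssociatedPrime p (Ra k K n α ⧸ idealSpec k K n α P) →
        toRa k K n α g ∉ p := by
  obtain ⟨c, hc, h⟩ := exists_ne_zero_mem_map_of_mul_mem (P.comap (toR k m n)) g fun x hx => by
    rw [Ideal.mem_comap, map_mul] at hx
    exact (Ideal.IsPrime.mem_or_mem ‹_› hx).resolve_left hg
  refine ⟨c, hc, fun α hα p hp hgp => ?_⟩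
  obtain ⟨hprime, x, rfl⟩ := isAssociatedPrime_iff.1 hp
  obtain ⟨x, rfl⟩ := Ideal.Quotient.mk_surjective x
  have hcolon (r : Ra k K n α) :
      r ∈ Submodule.colon (⊥ : Submodule (Ra k K n α) _)
          {Ideal.Quotient.mk (idealSpec k K n α P) x} ↔
        r * x ∈ idealSpec k K n α P := by
    rw [Submodule.mem_colon_singleton, Submodule.mem_bot, ← Ideal.Quotient.eq_zero_iff_mem]
    rfl
  refine hprime.ne_top ((Ideal.eq_top_iff_one _).2 ((hcolon 1).2 ?_))
  rw [one_mul]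
  exact h _ (evalα k K α) hα x ((hcolon _).1 hgp)

end Local

/-- specialization preserves short exact sequences: if
`0 → L → M → N → 0` is an exact sequence of finitely generated `S`-modules
(with maps `v : L → M`, `w : M → N` lifted to the chosen finite free
presentations), then for almost all `α` the specialized sequence
`0 → L_α → M_α → N_α → 0` is exact. -/
theorem specialization_preserves_short_exact_sequences
    (k K : Type) [Field k] [Field K] [Algebra k K] [Infinite K] {m n : ℕ}
    (P : Ideal (Rg k m n)) [P.IsPrime]
    (S : Type) [CommRing S] [Algebra (Rg k m n) S] [IsLocalization.AtPrime S P]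
    (L M N : Type) [AddCommGroup L] [Module S L] [Module.Finite S L]
    [AddCommGroup M] [Module S M] [Module.Finite S M]
    [AddCommGroup N] [Module S N] [Module.Finite S N]
    (v : L →ₗ[S] M) (w : M →ₗ[S] N)
    (hv : Function.Injective v) (hvw : LinearMap.range v = LinearMap.ker w)
    (hw : Function.Surjective w)
    {rL sL rM sM rN sN : ℕ}
    (pL : Present S rL sL L) (pM : Present S rM sM M) (pN : Present S rN sN N)
    (lv : MapLift pL pM v) (lw : MapLift pM pN w) :
    AlmostAll K m fun α =>
      ∀ (℘ : Ideal (Ra k K n α))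
        (h℘ : IsAssociatedPrime ℘ ((Ra k K n α) ⧸ idealSpec k K n α P)),
        haveI := h℘.isPrime
        ∀ (Sα : Type) [CommRing Sα] [Algebra (Ra k K n α) Sα]
          [IsLocalization.AtPrime Sα ℘]
          (BL : Matrix (Fin rL) (Fin sL) Sα) (BM : Matrix (Fin rM) (Fin sM) Sα)
          (BN : Matrix (Fin rN) (Fin sN) Sα)
          (V0 : Matrix (Fin rM) (Fin rL) Sα) (V1 : Matrix (Fin sM) (Fin sL) Sα)
          (W0 : Matrix (Fin rN) (Fin rM) Sα) (W1 : Matrix (Fin sN) (Fin sM) Sα),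
          MatSpec (LocElemSpec P ℘) pL.A BL → MatSpec (LocElemSpec P ℘) pM.A BM →
          MatSpec (LocElemSpec P ℘) pN.A BN →
          MatSpec (LocElemSpec P ℘) lv.V0 V0 → MatSpec (LocElemSpec P ℘) lv.V1 V1 →
          MatSpec (LocElemSpec P ℘) lw.V0 W0 → MatSpec (LocElemSpec P ℘) lw.V1 W1 →
          ∃ (h1 : V0 * BL = BM * V1) (h2 : W0 * BM = BN * W1),
            Function.Injective (cokerMap V0 (comm_le h1)) ∧
            LinearMap.range (cokerMap V0 (comm_le h1)) =
              LinearMap.ker (cokerMap W0 (comm_le h2)) ∧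
            Function.Surjective (cokerMap W0 (comm_le h2)) := by
  have hi := algebraMap_comp_toR_injective P (S := S)
  obtain ⟨B₀, hB₀⟩ := exists_denom_forall_exact hi (exists_denom_algebraMap_toR P) lv lw hv hvw hw
  obtain ⟨r, C₀, hBC, c₁, hc₁, hker⟩ := exists_ne_zero_ker_specialization B₀
  obtain ⟨g, hg, hexact⟩ := hB₀ r C₀ hBC
  have hgP : toR k m n g ∉ P := fun h =>
    (IsLocalization.AtPrime.isUnit_to_map_iff S P (toR k m n g)).1 hg h
  obtain ⟨c₂, hc₂, hassoc⟩ := exists_ne_zero_toRa_notMem (K := K) P hgP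
  obtain ⟨c, hc, hcα⟩ := almostAll_evalα_ne_zero (K := K) (mul_ne_zero hc₁ hc₂)
  refine ⟨c, hc, fun α hα ℘ h℘ => ?_⟩
  have h12 := mul_ne_zero_iff.1 ((map_mul (evalα k K α) c₁ c₂).symm.trans_ne (hcα α hα))
  have := h℘.isPrime
  intro Sα _ _ _ BL BM BN V0 V1 W0 W1 hBL hBM hBN hV0 hV1 hW0 hW1
  exact hexact Sα ((algebraMap (Ra k K n α) Sα).comp (toRa k K n α))
    (IsLocalization.map_units Sα (⟨toRa k K n α g, hassoc α h12.2 ℘ h℘⟩ : ℘.primeCompl))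
    (fun x hx => ker_mulVec_localization ℘ (hker _ (evalα k K α) h12.1) x hx)
    BL BM BN V0 V1 W0 W1 (fun x y => (hBL x y).fracSpec) (fun x y => (hBM x y).fracSpec)
    (fun x y => (hBN x y).fracSpec) (fun x y => (hV0 x y).fracSpec)
    (fun x y => (hV1 x y).fracSpec) (fun x y => (hW0 x y).fracSpec)
    (fun x y => (hW1 x y).fracSpec)

end Spl
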